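/- Radius comparison for intersecting balls under a scale-Lipschitz radius bound (estimate (ry_less_4r) in the proof of Lemma 5.2): Suppose (d_t)_{t∈I} satisfies condition (RF4) with constant K ≥ 1 and that I is unbounded below. Let 0 < τ ≤ 1, let R ≥ 40K satisfy τ²R ≥ 2K, and let 0 < δ ≤ 1/40. Let x, y ∈ M and r_x, r_y > 0 satisfy r_y ≤ 1.01·r_x + δ·D_R(x,y), let r ≥ r_x, and suppose that B̃_{τ²R}(y, 10·r_y) ∩ B̃_R(x, r) ≠ ∅. Then r_y ≤ 4r. -/

import Mathlib

open scoped ENNReal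

noncomputable section

/-- A family of distance functions `d t x y` on a set `M`, indexed by times `t` in a
set `I ⊆ ℝ` which is a nonempty interval with supremum `0`, such that `d t` is a
metric on `M` for every `t ∈ I`. -/
structure FlowMetric (M : Type*) (I : Set ℝ) where
  d : ℝ → M → M → ℝ
  ordConnected : I.OrdConnected
  nonempty : I.Nonempty
  isLUB_zero : IsLUB I 0
  d_self : ∀ t ∈ I, ∀ x : M, d t x x = 0
  eq_of_d_eq_zero : ∀ t ∈ I, ∀ x y : M, d t x y = 0 → x = y
  d_symm : ∀ t ∈ I, ∀ x y : M, d t x y = d t y x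
  d_triangle : ∀ t ∈ I, ∀ x y z : M, d t x z ≤ d t x y + d t y z

/-- Condition (RF4): the lower distance-distortion estimate with constant `K ≥ 1`:
`d_s(x,y) ≤ d_t(x,y) + K(√|s| − √|t|)` for all `s < t` in `I`. -/
def RF4 {M : Type*} {I : Set ℝ} (fm : FlowMetric M I) (K : ℝ) : Prop :=
  1 ≤ K ∧ ∀ x y : M, ∀ s ∈ I, ∀ t ∈ I, s < t →
    fm.d s x y ≤ fm.d t x y + K * (Real.sqrt |s| - Real.sqrt |t|)

/-- The set `I^ρ_{x,y}` of admissible scales: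
`{r > 0 : −r² ∈ I and d_{−r²}(x,y) < ρ·r}`. -/
def scaleSet {M : Type*} {I : Set ℝ} (fm : FlowMetric M I) (ρ : ℝ) (x y : M) : Set ℝ :=
  {r : ℝ | 0 < r ∧ -r ^ 2 ∈ I ∧ fm.d (-r ^ 2) x y < ρ * r}

/-- The `ρ`-scale `D_ρ(x,y) = inf I^ρ_{x,y} ∈ [0,+∞]`, equal to `+∞` when
`I^ρ_{x,y} = ∅`. -/
def Dscale {M : Type*} {I : Set ℝ} (fm : FlowMetric M I) (ρ : ℝ) (x y : M) : ℝ≥0∞ :=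
  ⨅ r ∈ scaleSet fm ρ x y, ENNReal.ofReal r

/-- The ball `B̃_ρ(x,r) = {y : d_{−r²}(x,y) < ρ·r}`. -/
def tball {M : Type*} {I : Set ℝ} (fm : FlowMetric M I) (ρ : ℝ) (x : M) (r : ℝ) : Set M :=
  {y : M | fm.d (-r ^ 2) x y < ρ * r}

/-- An interval with supremum `0` that is unbounded below contains every negative time. -/
theorem FlowMetric.mem_of_neg {M : Type*} {I : Set ℝ} (fm : FlowMetric M I)
    (hI : ¬ BddBelow I) {t : ℝ} (ht : t < 0) : t ∈ I := by
  obtain ⟨a, ha, hat⟩ := not_bddBelow_iff.mp hI t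
  obtain ⟨b, hb, htb⟩ := (lt_isLUB_iff fm.isLUB_zero).mp ht
  exact fm.ordConnected.out ha hb ⟨hat.le, htb.le⟩

/-- Condition (RF4) in terms of scales: `d_{−b²}(x,y) ≤ d_{−a²}(x,y) + K(b − a)` for
`0 < a < b`. -/
theorem RF4.d_neg_sq_le {M : Type*} {I : Set ℝ} {fm : FlowMetric M I} {K : ℝ}
    (h : RF4 fm K) (hI : ¬ BddBelow I) {a b : ℝ} (ha : 0 < a) (hab : a < b) (x y : M) :
    fm.d (-b ^ 2) x y ≤ fm.d (-a ^ 2) x y + K * (b - a) := by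
  have hb : 0 < b := ha.trans hab
  have key := h.2 x y (-b ^ 2) (fm.mem_of_neg hI (by nlinarith)) (-a ^ 2)
    (fm.mem_of_neg hI (by nlinarith)) (by nlinarith)
  rwa [abs_neg, abs_neg, abs_of_nonneg (sq_nonneg b), abs_of_nonneg (sq_nonneg a),
    Real.sqrt_sq hb.le, Real.sqrt_sq ha.le] at key

/-- **Radius comparison for intersecting balls under a scale-Lipschitz radius
bound** (estimate (ry_less_4r) in the proof of Lemma 5.2). Assume (RF4) with
constant `K ≥ 1` and `I` unbounded below. Let `0 < τ ≤ 1`, `R ≥ 40K` with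
`τ²R ≥ 2K`, and `0 < δ ≤ 1/40`. If `r_y ≤ 1.01·r_x + δ·D_R(x,y)`, `r ≥ r_x`,
and `B̃_{τ²R}(y, 10·r_y) ∩ B̃_R(x, r) ≠ ∅`, then `r_y ≤ 4r`. -/
theorem radius_le_of_balls_intersect
    {M : Type*} {I : Set ℝ} (fm : FlowMetric M I) {K : ℝ} (hRF4 : RF4 fm K)
    (hI : ¬ BddBelow I)
    {τ R : ℝ} (hτ0 : 0 < τ) (hτ1 : τ ≤ 1) (hR : 40 * K ≤ R) (hτR : 2 * K ≤ τ ^ 2 * R)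
    {δ : ℝ} (hδ0 : 0 < δ) (hδ : δ ≤ 1 / 40)
    (x y : M) {rx ry : ℝ} (hrx : 0 < rx) (hry : 0 < ry)
    (hlip : ENNReal.ofReal ry ≤
      ENNReal.ofReal (1.01 * rx) + ENNReal.ofReal δ * Dscale fm R x y)
    {r : ℝ} (hr : rx ≤ r)
    (hint : (tball fm (τ ^ 2 * R) y (10 * ry) ∩ tball fm R x r).Nonempty) :
    ry ≤ 4 * r := by
  by_contra! hlt
  obtain ⟨z, hz1, hz2⟩ := hint
  simp only [tball, Set.mem_ofPred_eq] at hz1 hz2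
  have hK : 1 ≤ K := hRF4.1
  have hr0 : 0 < r := hrx.trans_le hr
  have hτ2 : τ ^ 2 * R * (10 * ry) ≤ R * (10 * ry) := by
    have : τ ^ 2 ≤ 1 := pow_le_one₀ hτ0.le hτ1
    have hR0 : 0 ≤ R := by linarith
    gcongr
    exact mul_le_of_le_one_left hR0 this
  obtain ⟨L, hL⟩ : ∃ L, L = 40 / 39 * (10 * ry) + r := ⟨_, rfl⟩
  have hL0 : 0 < L := by linarith
  have hs : -(10 * ry) ^ 2 ∈ I := fm.mem_of_neg hI (by nlinarith)
  have hxz := hRF4.d_neg_sq_le hI hr0 (show r < 10 * ry by linarith) x z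
  have hxy := hRF4.d_neg_sq_le hI (show 0 < 10 * ry by linarith)
    (show 10 * ry < L by linarith) x y
  have htri := fm.d_triangle _ hs x z y
  rw [fm.d_symm _ hs z y] at htri
  have hdist : K * (L - r) ≤ R / 40 * (L - r) :=
    mul_le_mul_of_nonneg_right (by linarith) (by linarith)
  have hmem : L ∈ scaleSet fm R x y := by
    refine ⟨hL0, fm.mem_of_neg hI (by nlinarith), ?_⟩
    have hRL : R * (10 * ry) + R * r + R / 40 * (L - r) = R * L := by
      rw [hL]; ring
    linarith
  have hD : Dscale fm R x y ≤ ENNReal.ofReal L := iInf₂_le L hmem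
  have hle : ENNReal.ofReal ry ≤ ENNReal.ofReal (1.01 * rx + δ * L) := by
    rw [ENNReal.ofReal_add (by positivity) (by positivity), ENNReal.ofReal_mul hδ0.le]
    exact hlip.trans (by gcongr)
  have hreal := (ENNReal.ofReal_le_ofReal_iff (by positivity)).mp hle
  have hδL : δ * L ≤ 1 / 40 * L := mul_le_mul_of_nonneg_right hδ hL0.le
  linarith
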